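/- Fix b > 0, T > 0, H > 0, a boundary influx h ∈ C([0,T]) with h > 0 on [0,T], and an initial state u₀ ∈ C([0,b]) with 0 ≤ u₀(x) ≤ H(b−x) on [0,b]; set M = max(sup_{[0,T]} h, H). If (s, u) is a classical solution of the one-phase Stefan problem with data (b, u₀, h) on [0,T], then 0 < u(x,t) ≤ M(s(t) − x) for all (x,t) ∈ Q_{s,T}. -/

import Mathlib

open Set MeasureTheory Real

noncomputable section

/-- The space-time domain `Q_{s,T} = {(x,t) : 0 < x < s(t), 0 < t < T}`. -/
def stefanQ (T : ℝ) (s : ℝ → ℝ) : Set (ℝ × ℝ) :=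
  {p : ℝ × ℝ | 0 < p.1 ∧ p.1 < s p.2 ∧ 0 < p.2 ∧ p.2 < T}

/-- A classical solution `(s, u)` of the one-phase Stefan problem with data `(b, u₀, h)`
on `[0,T]`. -/
structure IsStefanSolution (b T : ℝ) (u₀ h : ℝ → ℝ) (s : ℝ → ℝ) (u : ℝ → ℝ → ℝ) : Prop where
  s_pos : ∀ t ∈ Icc (0:ℝ) T, 0 < s t
  s_init : s 0 = b
  s_lipschitz : ∃ L : NNReal, LipschitzOnWith L s (Icc 0 T)
  s_diff : ∀ t ∈ Ioc (0:ℝ) T, HasDerivAt s (deriv s t) t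
  s_deriv_cont : ContinuousOn (deriv s) (Ioc 0 T)
  u_cont : ContinuousOn (fun p : ℝ × ℝ => u p.1 p.2) (closure (stefanQ T s))
  u_x : ∀ x t, (x, t) ∈ stefanQ T s →
    HasDerivAt (fun y => u y t) (deriv (fun y => u y t) x) x
  u_xx : ∀ x t, (x, t) ∈ stefanQ T s →
    HasDerivAt (fun y => deriv (fun z => u z t) y)
      (deriv (fun y => deriv (fun z => u z t) y) x) x
  heat : ∀ x t, (x, t) ∈ stefanQ T s →
    HasDerivAt (fun τ => u x τ) (deriv (fun y => deriv (fun z => u z t) y) x) t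
  flux : ∀ t ∈ Ioo (0:ℝ) T, deriv (fun y => u y t) 0 = -(h t)
  init : ∀ x ∈ Ioo (0:ℝ) b, u x 0 = u₀ x
  stefan_cond : ∀ t ∈ Ioo (0:ℝ) T, deriv (fun y => u y t) (s t) = -(deriv s t)
  front_zero : ∀ t ∈ Ioo (0:ℝ) T, u (s t) t = 0

/-- The `W^{1,∞}` norm of `s` on `[0,T]`: `max(sup |s|, ess sup |s'|)`. -/
def W1inf (T : ℝ) (s : ℝ → ℝ) : ℝ :=
  max (sSup ((fun t => |s t|) '' Icc (0:ℝ) T))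
    (essSup (fun t => |deriv s t|) (volume.restrict (Icc (0:ℝ) T)))

/-- The heat kernel `K(x,ξ;t,τ)`. -/
def Kker (x ξ t τ : ℝ) : ℝ :=
  (2 * Real.sqrt (π * (t - τ)))⁻¹ * Real.exp (-(x - ξ)^2 / (4 * (t - τ)))

/-- The Neumann function `N(x,ξ;t,τ) = K(x,ξ;t,τ) + K(-x,ξ;t,τ)`. -/
def Nker (x ξ t τ : ℝ) : ℝ := Kker x ξ t τ + Kker (-x) ξ t τ

/-- The Abel operator `A₀ g (t) = (1/√π) ∫₀ᵗ g(τ)/√(t-τ) dτ`. -/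
def abelOp (g : ℝ → ℝ) (t : ℝ) : ℝ :=
  (Real.sqrt π)⁻¹ * ∫ τ in (0:ℝ)..t, g τ / Real.sqrt (t - τ)

open Filter Topology

/-- A function lying above its value at `a` to the right of `a` has nonnegative right
derivative there. -/
lemma nonneg_of_hasDerivWithinAt_Ioi_of_le {f : ℝ → ℝ} {a d : ℝ}
    (hd : HasDerivWithinAt f d (Ioi a) a) (hf : ∀ᶠ x in 𝓝[>] a, f a ≤ f x) : 0 ≤ d := by
  rw [hasDerivWithinAt_iff_tendsto_slope' self_notMem_Ioi] at hd
  refine ge_of_tendsto hd ?_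
  filter_upwards [hf, self_mem_nhdsWithin] with x hx hax
  rw [slope_def_field]
  exact div_nonneg (sub_nonneg.2 hx) (sub_nonneg.2 (le_of_lt hax))

/-- A function lying above its value at `a` to the left of `a` has nonpositive left
derivative there. -/
lemma nonpos_of_hasDerivWithinAt_Iio_of_le {f : ℝ → ℝ} {a d : ℝ}
    (hd : HasDerivWithinAt f d (Iio a) a) (hf : ∀ᶠ x in 𝓝[<] a, f a ≤ f x) : d ≤ 0 := by
  rw [hasDerivWithinAt_iff_tendsto_slope' self_notMem_Iio] at hd
  refine le_of_tendsto hd ?_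
  filter_upwards [hf, self_mem_nhdsWithin] with x hx hax
  rw [slope_def_field]
  exact div_nonpos_of_nonneg_of_nonpos (sub_nonneg.2 hx) (sub_nonpos.2 (le_of_lt hax))

/-- The second derivative at a local minimum is nonnegative. -/
lemma IsLocalMin.second_deriv_nonneg {f p : ℝ → ℝ} {a c : ℝ} (hmin : IsLocalMin f a)
    (hp : ∀ᶠ x in 𝓝 a, HasDerivAt f (p x) x) (hc : HasDerivAt p c a) : 0 ≤ c := by
  by_contra! hneg
  have hev : deriv f =ᶠ[𝓝 a] p := hp.mono fun x hx => hx.deriv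
  have hdd : deriv (deriv f) a = c := by rw [hev.deriv_eq, hc.deriv]
  have hmax : IsLocalMax f a :=
    isLocalMax_of_deriv_deriv_neg (hdd ▸ hneg) hmin.deriv_eq_zero hp.self_of_nhds.continuousAt
  have hconst : f =ᶠ[𝓝 a] fun _ => f a := by
    filter_upwards [hmin, hmax] with x h₁ h₂ using le_antisymm h₂ h₁
  have hzero : deriv f =ᶠ[𝓝 a] fun _ => 0 := by
    simpa using hconst.deriv
  rw [hzero.deriv_eq, deriv_const] at hdd
  exact hneg.ne hdd.symm

/-- The closed space-time region `0 ≤ x ≤ σ(t)`, `t₁ ≤ t ≤ t₀`. -/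
def closedRegion (t₁ t₀ : ℝ) (σ : ℝ → ℝ) : Set (ℝ × ℝ) :=
  {p : ℝ × ℝ | p.2 ∈ Icc t₁ t₀ ∧ p.1 ∈ Icc 0 (σ p.2)}

lemma closedRegion_eq_image {t₁ t₀ : ℝ} {σ : ℝ → ℝ} (hpos : ∀ t ∈ Icc t₁ t₀, 0 < σ t) :
    closedRegion t₁ t₀ σ =
      (fun q : ℝ × ℝ => (q.1 * σ q.2, q.2)) '' (Icc 0 1 ×ˢ Icc t₁ t₀) := by
  ext ⟨x, t⟩
  constructor
  · rintro ⟨ht, hx⟩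
    have hσ := hpos t ht
    exact ⟨(x / σ t, t), ⟨⟨div_nonneg hx.1 hσ.le, (div_le_one hσ).2 hx.2⟩, ht⟩,
      Prod.ext (div_mul_cancel₀ x hσ.ne') rfl⟩
  · rintro ⟨⟨θ, τ⟩, ⟨hθ, hτ⟩, heq⟩
    obtain ⟨rfl, rfl⟩ := Prod.ext_iff.1 heq
    have hσ := hpos τ hτ
    exact ⟨hτ, mul_nonneg hθ.1 hσ.le, mul_le_of_le_one_left hσ.le hθ.2⟩

lemma continuousOn_rescale {t₁ t₀ : ℝ} {σ : ℝ → ℝ} (hσ : ContinuousOn σ (Icc t₁ t₀)) :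
    ContinuousOn (fun q : ℝ × ℝ => (q.1 * σ q.2, q.2)) (Icc 0 1 ×ˢ Icc t₁ t₀) :=
  (continuousOn_fst.mul (hσ.comp continuousOn_snd fun _ hq => hq.2)).prodMk continuousOn_snd

lemma isCompact_closedRegion {t₁ t₀ : ℝ} {σ : ℝ → ℝ} (hσ : ContinuousOn σ (Icc t₁ t₀))
    (hpos : ∀ t ∈ Icc t₁ t₀, 0 < σ t) : IsCompact (closedRegion t₁ t₀ σ) := by
  rw [closedRegion_eq_image hpos]
  exact (isCompact_Icc.prod isCompact_Icc).image_of_continuousOn (continuousOn_rescale hσ)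

/-- Weak minimum principle for strict supersolutions of the heat equation below a moving
boundary `x = σ(t)`; at `x = 0` either a sign or a negative normal derivative is prescribed. -/
theorem nonneg_of_strict_supersolution {t₁ t₀ : ℝ} {σ : ℝ → ℝ}
    (hσ : ContinuousOn σ (Icc t₁ t₀)) (hpos : ∀ t ∈ Icc t₁ t₀, 0 < σ t) {w : ℝ → ℝ → ℝ}
    (hw : ContinuousOn (fun p : ℝ × ℝ => w p.1 p.2) (closedRegion t₁ t₀ σ))
    (hfront : ∀ t ∈ Ioc t₁ t₀, 0 ≤ w (σ t) t)
    (hinit : ∀ x ∈ Icc 0 (σ t₁), 0 ≤ w x t₁)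
    (hleft : ∀ t ∈ Ioc t₁ t₀,
      0 ≤ w 0 t ∨ ∃ d < 0, HasDerivWithinAt (fun y => w y t) d (Ioi 0) 0)
    (hint : ∀ t ∈ Ioc t₁ t₀, ∀ x ∈ Ioo 0 (σ t), ∃ (p : ℝ → ℝ) (a c : ℝ),
      (∀ᶠ y in 𝓝 x, HasDerivAt (fun z => w z t) (p y) y) ∧ HasDerivAt p c x ∧
        HasDerivAt (fun τ => w x τ) a t ∧ c < a) :
    ∀ p ∈ closedRegion t₁ t₀ σ, 0 ≤ w p.1 p.2 := by
  intro p₀ hp₀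
  obtain ⟨⟨x, t⟩, ⟨ht, hx⟩, hmin⟩ :=
    (isCompact_closedRegion hσ hpos).exists_isMinOn ⟨p₀, hp₀⟩ hw
  refine le_trans ?_ (hmin hp₀)
  have hle : ∀ y τ, τ ∈ Icc t₁ t₀ → y ∈ Icc 0 (σ τ) → w x t ≤ w y τ :=
    fun y τ hτ hy => hmin (a := (y, τ)) ⟨hτ, hy⟩
  dsimp only at ht hx ⊢
  rcases ht.1.eq_or_lt with rfl | ht₁
  · exact hinit x hx
  have ht' : t ∈ Ioc t₁ t₀ := ⟨ht₁, ht.2⟩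
  rcases hx.2.eq_or_lt with rfl | hxσ
  · exact hfront t ht'
  rcases hx.1.eq_or_lt with rfl | hx₀
  · rcases hleft t ht' with h₀ | ⟨d, hd, hder⟩
    · exact h₀
    · refine absurd (nonneg_of_hasDerivWithinAt_Ioi_of_le hder ?_) hd.not_ge
      filter_upwards [Ioo_mem_nhdsGT hxσ] with y hy
      exact hle y t ht (Ioo_subset_Icc_self hy)
  exfalso
  obtain ⟨q, a, c, hq, hc, ha, hca⟩ := hint t ht' x ⟨hx₀, hxσ⟩
  have hmin_x : IsLocalMin (fun z => w z t) x := by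
    filter_upwards [Ioo_mem_nhds hx₀ hxσ] with y hy
    exact hle y t ht (Ioo_subset_Icc_self hy)
  have hc₀ : 0 ≤ c := hmin_x.second_deriv_nonneg hq hc
  have hmem : ∀ᶠ τ in 𝓝[<] t, τ ∈ Icc t₁ t₀ := by
    filter_upwards [Ioo_mem_nhdsLT ht₁] with τ hτ
    exact ⟨hτ.1.le, hτ.2.le.trans ht.2⟩
  have hlt : ∀ᶠ τ in 𝓝[<] t, x < σ τ :=
    ((hσ t ht).mono_of_mem_nhdsWithin hmem).eventually_const_lt hxσ
  have ha₀ : a ≤ 0 := by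
    refine nonpos_of_hasDerivWithinAt_Iio_of_le ha.hasDerivWithinAt ?_
    filter_upwards [hmem, hlt] with τ hτ hτ'
    exact hle x τ hτ ⟨hx₀.le, hτ'.le⟩
  linarith

namespace IsStefanSolution

variable {b T : ℝ} {u₀ h s : ℝ → ℝ} {u : ℝ → ℝ → ℝ}

lemma continuousOn_s (hsol : IsStefanSolution b T u₀ h s u) : ContinuousOn s (Icc 0 T) := by
  obtain ⟨L, hL⟩ := hsol.s_lipschitz
  exact hL.continuousOn

lemma closedRegion_subset_closure (hsol : IsStefanSolution b T u₀ h s u) (hT : 0 < T) :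
    closedRegion 0 T s ⊆ closure (stefanQ T s) := by
  rw [closedRegion_eq_image hsol.s_pos]
  have hcl : closure (Ioo (0 : ℝ) 1 ×ˢ Ioo 0 T) = Icc 0 1 ×ˢ Icc 0 T := by
    rw [closure_prod_eq, closure_Ioo zero_ne_one, closure_Ioo hT.ne]
  have hmaps : MapsTo (fun q : ℝ × ℝ => (q.1 * s q.2, q.2))
      (Ioo 0 1 ×ˢ Ioo 0 T) (stefanQ T s) := by
    rintro ⟨θ, t⟩ ⟨hθ, ht⟩
    have hs := hsol.s_pos t (Ioo_subset_Icc_self ht)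
    exact ⟨mul_pos hθ.1 hs, mul_lt_of_lt_one_left hs hθ.2, ht.1, ht.2⟩
  have := hmaps.closure_of_continuousOn (hcl ▸ continuousOn_rescale hsol.continuousOn_s)
  rw [hcl] at this
  exact this.image_subset

lemma continuousOn_closedRegion (hsol : IsStefanSolution b T u₀ h s u) (hT : 0 < T) :
    ContinuousOn (fun p : ℝ × ℝ => u p.1 p.2) (closedRegion 0 T s) :=
  hsol.u_cont.mono (hsol.closedRegion_subset_closure hT)

/-- The initial condition persists at the endpoints of `[0,b]`. -/
lemma init_Icc (hsol : IsStefanSolution b T u₀ h s u) (hb : 0 < b) (hT : 0 < T)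
    (hu₀c : ContinuousOn u₀ (Icc 0 b)) : ∀ x ∈ Icc 0 b, u x 0 = u₀ x := by
  have hcont : ContinuousOn (fun x => u x 0) (Icc 0 b) := by
    refine (hsol.continuousOn_closedRegion hT).comp (f := fun x : ℝ => (x, (0 : ℝ)))
      (by fun_prop) ?_
    intro x hx
    exact ⟨left_mem_Icc.2 hT.le, by simpa [hsol.s_init] using hx⟩
  have heq : EqOn (fun x => u x 0) u₀ (Ioo 0 b) := hsol.init
  exact heq.of_subset_closure hcont hu₀c Ioo_subset_Icc_self (closure_Ioo hb.ne).ge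

lemma flux_hasDerivAt (hsol : IsStefanSolution b T u₀ h s u)
    (hhpos : ∀ t ∈ Icc (0 : ℝ) T, 0 < h t) {t : ℝ} (ht : t ∈ Ioo 0 T) :
    HasDerivAt (fun y => u y t) (-(h t)) 0 := by
  have hflux := hsol.flux t ht
  rw [← hflux]
  refine (differentiableAt_of_deriv_ne_zero ?_).hasDerivAt
  rw [hflux]
  exact (neg_neg_of_pos (hhpos t (Ioo_subset_Icc_self ht))).ne

lemma eventually_hasDerivAt (hsol : IsStefanSolution b T u₀ h s u) {x t : ℝ}
    (hxt : (x, t) ∈ stefanQ T s) :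
    ∀ᶠ y in 𝓝 x, HasDerivAt (fun z => u z t) (deriv (fun z => u z t) y) y := by
  filter_upwards [Ioo_mem_nhds hxt.1 hxt.2.1] with y hy
  exact hsol.u_x y t ⟨hy.1, hy.2, hxt.2.2⟩

lemma nonneg (hsol : IsStefanSolution b T u₀ h s u) (hb : 0 < b)
    (hhpos : ∀ t ∈ Icc (0 : ℝ) T, 0 < h t) (hu₀c : ContinuousOn u₀ (Icc 0 b))
    (hu₀ : ∀ x ∈ Icc 0 b, 0 ≤ u₀ x) {x t : ℝ} (ht : t ∈ Ioo 0 T) (hx : x ∈ Icc 0 (s t)) :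
    0 ≤ u x t := by
  have hT := ht.1.trans ht.2
  have hsub : Icc 0 t ⊆ Icc 0 T := Icc_subset_Icc_right ht.2.le
  have hlift : ∀ τ ∈ Ioc 0 t, τ ∈ Ioo 0 T := fun τ hτ => ⟨hτ.1, hτ.2.trans_lt ht.2⟩
  have key : ∀ ε > 0, 0 ≤ u x t + ε * t := by
    intro ε hε
    refine nonneg_of_strict_supersolution (w := fun y τ => u y τ + ε * τ)
      (hsol.continuousOn_s.mono hsub) (fun τ hτ => hsol.s_pos τ (hsub hτ)) ?_ ?_ ?_ ?_ ?_
      (x, t) ⟨right_mem_Icc.2 ht.1.le, hx⟩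
    · exact ((hsol.continuousOn_closedRegion hT).mono fun p hp => ⟨hsub hp.1, hp.2⟩).add
        (by fun_prop)
    · intro τ hτ
      simpa [hsol.front_zero τ (hlift τ hτ)] using mul_nonneg hε.le hτ.1.le
    · intro y hy
      rw [hsol.s_init] at hy
      simpa [hsol.init_Icc hb hT hu₀c y hy] using hu₀ y hy
    · intro τ hτ
      exact .inr ⟨_, neg_neg_of_pos (hhpos τ (Ioo_subset_Icc_self (hlift τ hτ))),
        ((hsol.flux_hasDerivAt hhpos (hlift τ hτ)).add_const (ε * τ)).hasDerivWithinAt⟩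
    · intro τ hτ y hy
      have hQ : (y, τ) ∈ stefanQ T s := ⟨hy.1, hy.2, hlift τ hτ⟩
      exact ⟨_, _, _, (hsol.eventually_hasDerivAt hQ).mono fun z hz => hz.add_const (ε * τ),
        hsol.u_xx y τ hQ, (hsol.heat y τ hQ).add ((hasDerivAt_id τ).const_mul ε), by simpa⟩
  refine le_of_forall_pos_le_add fun ε hε => ?_
  simpa [div_mul_cancel₀ ε ht.1.ne'] using key (ε / t) (div_pos hε ht.1)

lemma pos_at_zero (hsol : IsStefanSolution b T u₀ h s u) (hb : 0 < b)
    (hhpos : ∀ t ∈ Icc (0 : ℝ) T, 0 < h t) (hu₀c : ContinuousOn u₀ (Icc 0 b))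
    (hu₀ : ∀ x ∈ Icc 0 b, 0 ≤ u₀ x) {t : ℝ} (ht : t ∈ Ioo 0 T) : 0 < u 0 t := by
  have ht' := Ioo_subset_Icc_self ht
  have hs := hsol.s_pos t ht'
  refine (hsol.nonneg hb hhpos hu₀c hu₀ ht (left_mem_Icc.2 hs.le)).lt_of_ne' fun hzero => ?_
  refine absurd (nonneg_of_hasDerivWithinAt_Ioi_of_le
    (hsol.flux_hasDerivAt hhpos ht).hasDerivWithinAt ?_) (neg_neg_of_pos (hhpos t ht')).not_ge
  filter_upwards [Ioo_mem_nhdsGT hs] with y hy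
  rw [hzero]
  exact hsol.nonneg hb hhpos hu₀c hu₀ ht (Ioo_subset_Icc_self hy)

/-- Interior positivity, by comparison with a travelling-wave subsolution entering
from `x = 0`. -/
lemma pos (hsol : IsStefanSolution b T u₀ h s u) (hb : 0 < b)
    (hhpos : ∀ t ∈ Icc (0 : ℝ) T, 0 < h t) (hu₀c : ContinuousOn u₀ (Icc 0 b))
    (hu₀ : ∀ x ∈ Icc 0 b, 0 ≤ u₀ x) {x t : ℝ} (hxt : (x, t) ∈ stefanQ T s) : 0 < u x t := by
  obtain ⟨hx, hxs, ht⟩ := hxt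
  dsimp only at hx hxs ht
  change t ∈ Ioo 0 T at ht
  have hT := ht.1.trans ht.2
  obtain ⟨x₁, hxx₁, hx₁s⟩ := exists_between hxs
  have hx₁ : 0 < x₁ := hx.trans hxx₁
  have hev : ∀ᶠ τ in 𝓝 t, x₁ < s τ := by
    have hs : ContinuousAt s t := (hsol.s_diff t ⟨ht.1, ht.2.le⟩).continuousAt
    exact hs.eventually_const_lt hx₁s
  obtain ⟨l, hl, hls⟩ := exists_Ioc_subset_of_mem_nhds hev ⟨0, ht.1⟩
  obtain ⟨t₁, ht₁, ht₁t⟩ := exists_between (max_lt hl ht.1)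
  obtain ⟨hlt₁, ht₁0⟩ := max_lt_iff.1 ht₁
  have hlift : ∀ τ ∈ Icc t₁ t, τ ∈ Ioo 0 T :=
    fun τ hτ => ⟨ht₁0.trans_le hτ.1, hτ.2.trans_lt ht.2⟩
  have hsx : ∀ τ ∈ Icc t₁ t, x₁ < s τ := fun τ hτ => hls ⟨hlt₁.trans_le hτ.1, hτ.2⟩
  have hcont : ContinuousOn (fun p : ℝ × ℝ => u p.1 p.2) (closedRegion t₁ t fun _ => x₁) :=
    (hsol.continuousOn_closedRegion hT).mono fun p hp =>
      ⟨Ioo_subset_Icc_self (hlift _ hp.1), hp.2.1, hp.2.2.trans (hsx _ hp.1).le⟩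
  have hnonneg : ∀ τ ∈ Icc t₁ t, ∀ y ∈ Icc 0 x₁, 0 ≤ u y τ := fun τ hτ y hy =>
    hsol.nonneg hb hhpos hu₀c hu₀ (hlift τ hτ) ⟨hy.1, hy.2.trans (hsx τ hτ).le⟩
  obtain ⟨δ, hδ, hδu⟩ : ∃ δ > 0, ∀ τ ∈ Icc t₁ t, δ ≤ u 0 τ := by
    have hcont₀ : ContinuousOn (fun τ => u 0 τ) (Icc t₁ t) :=
      hcont.comp (f := fun τ : ℝ => ((0 : ℝ), τ)) (by fun_prop)
        fun τ hτ => ⟨hτ, left_mem_Icc.2 hx₁.le⟩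
    obtain ⟨τ₀, hτ₀, hmin⟩ := isCompact_Icc.exists_isMinOn (nonempty_Icc.2 ht₁t.le) hcont₀
    exact ⟨u 0 τ₀, hsol.pos_at_zero hb hhpos hu₀c hu₀ (hlift τ₀ hτ₀), fun τ hτ => hmin hτ⟩
  set c : ℝ := x₁ / (t - t₁)
  have htt₁ : 0 < t - t₁ := sub_pos.2 ht₁t
  have hc : 0 < c := div_pos hx₁ htt₁
  have hct : c * (t - t₁) = x₁ := div_mul_cancel₀ _ htt₁.ne'
  have hcτ : ∀ τ ∈ Icc t₁ t, c * (τ - t₁) ≤ x₁ := fun τ hτ =>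
    hct ▸ mul_le_mul_of_nonneg_left (sub_le_sub_right hτ.2 _) hc.le
  have hk : 0 < c + 1 := by linarith
  set ε : ℝ := δ / exp ((c + 1) * x₁)
  have hε : 0 < ε := div_pos hδ (exp_pos _)
  let E : ℝ → ℝ → ℝ := fun y τ => exp ((c + 1) * (c * (τ - t₁) - y))
  have hE_le_one : ∀ y τ, c * (τ - t₁) ≤ y → E y τ ≤ 1 := fun y τ hyτ =>
    exp_le_one_iff.2 (mul_nonpos_of_nonneg_of_nonpos hk.le (sub_nonpos.2 hyτ))
  have hEx : ∀ y τ, HasDerivAt (fun z => E z τ) (-(c + 1) * E y τ) y := by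
    intro y τ
    have := (((hasDerivAt_id y).const_sub (c * (τ - t₁))).const_mul (c + 1)).exp
    refine this.congr_deriv ?_
    change E y τ * _ = _
    ring
  have hEt : ∀ y τ, HasDerivAt (fun r => E y r) ((c + 1) * c * E y τ) τ := by
    intro y τ
    have := (((((hasDerivAt_id τ).sub_const t₁).const_mul c).sub_const y).const_mul (c + 1)).exp
    refine this.congr_deriv ?_
    change E y τ * _ = _
    ring
  have hcomp := nonneg_of_strict_supersolution (w := fun y τ => u y τ - ε * (E y τ - 1))
    (t₁ := t₁) (t₀ := t) (σ := fun _ => x₁) continuousOn_const (fun _ _ => hx₁)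
    (hcont.sub (by fun_prop)) ?_ ?_ ?_ ?_ (x, t) ⟨right_mem_Icc.2 ht₁t.le, hx.le, hxx₁.le⟩
  · have hE : 1 < E x t := one_lt_exp_iff.2 (mul_pos hk (by rw [hct]; linarith))
    dsimp only at hcomp
    nlinarith [mul_pos hε (sub_pos.2 hE)]
  · intro τ hτ
    have hτ' := Ioc_subset_Icc_self hτ
    have h₁ := hnonneg τ hτ' x₁ (right_mem_Icc.2 hx₁.le)
    have h₂ := hE_le_one x₁ τ (hcτ τ hτ')
    nlinarith
  · intro y hy
    have h₁ := hnonneg t₁ (left_mem_Icc.2 ht₁t.le) y hy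
    have h₂ := hE_le_one y t₁ (by simpa using hy.1)
    nlinarith
  · intro τ hτ
    have hτ' := Ioc_subset_Icc_self hτ
    left
    have h₁ : E 0 τ ≤ exp ((c + 1) * x₁) :=
      exp_le_exp.2 (mul_le_mul_of_nonneg_left (by simpa using hcτ τ hτ') hk.le)
    have h₂ : ε * exp ((c + 1) * x₁) = δ := div_mul_cancel₀ _ (exp_pos _).ne'
    have h₃ := mul_le_mul_of_nonneg_left h₁ hε.le
    linarith [hδu τ hτ']
  · intro τ hτ y hy
    have hτ' := Ioc_subset_Icc_self hτ
    have hQ : (y, τ) ∈ stefanQ T s := ⟨hy.1, hy.2.trans (hsx τ hτ'), hlift τ hτ'⟩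
    refine ⟨_, _, _, (hsol.eventually_hasDerivAt hQ).mono fun z hz =>
        hz.sub (((hEx z τ).sub_const 1).const_mul ε),
      (hsol.u_xx y τ hQ).sub (((hEx y τ).const_mul (-(c + 1))).const_mul ε),
      (hsol.heat y τ hQ).sub (((hEt y τ).sub_const 1).const_mul ε), ?_⟩
    have : 0 < ε * ((c + 1) * E y τ) := mul_pos hε (mul_pos hk (exp_pos _))
    linarith

/-- The front never recedes. -/
lemma deriv_front_nonneg (hsol : IsStefanSolution b T u₀ h s u) (hb : 0 < b)
    (hhpos : ∀ t ∈ Icc (0 : ℝ) T, 0 < h t) (hu₀c : ContinuousOn u₀ (Icc 0 b))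
    (hu₀ : ∀ x ∈ Icc 0 b, 0 ≤ u₀ x) {t : ℝ} (ht : t ∈ Ioo 0 T) : 0 ≤ deriv s t := by
  by_contra! hneg
  have hcond := hsol.stefan_cond t ht
  have hder : HasDerivAt (fun y => u y t) (-(deriv s t)) (s t) := by
    rw [← hcond]
    refine (differentiableAt_of_deriv_ne_zero ?_).hasDerivAt
    rw [hcond]
    exact (neg_pos.2 hneg).ne'
  refine absurd (nonpos_of_hasDerivWithinAt_Iio_of_le hder.hasDerivWithinAt ?_)
    (neg_pos.2 hneg).not_ge
  filter_upwards [Ioo_mem_nhdsLT (hsol.s_pos t (Ioo_subset_Icc_self ht))] with y hy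
  rw [hsol.front_zero t ht]
  exact hsol.nonneg hb hhpos hu₀c hu₀ ht (Ioo_subset_Icc_self hy)

lemma le_linear (hsol : IsStefanSolution b T u₀ h s u) (hb : 0 < b)
    (hhpos : ∀ t ∈ Icc (0 : ℝ) T, 0 < h t) (hu₀c : ContinuousOn u₀ (Icc 0 b))
    (hu₀ : ∀ x ∈ Icc 0 b, 0 ≤ u₀ x) {M : ℝ} (hM : 0 ≤ M) (hhM : ∀ t ∈ Icc (0 : ℝ) T, h t ≤ M)
    (hu₀M : ∀ x ∈ Icc 0 b, u₀ x ≤ M * (b - x)) {x t : ℝ} (ht : t ∈ Ioo 0 T)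
    (hx : x ∈ Icc 0 (s t)) : u x t ≤ M * (s t - x) := by
  have hT := ht.1.trans ht.2
  have hsub : Icc 0 t ⊆ Icc 0 T := Icc_subset_Icc_right ht.2.le
  have hlift : ∀ τ ∈ Ioc 0 t, τ ∈ Ioo 0 T := fun τ hτ => ⟨hτ.1, hτ.2.trans_lt ht.2⟩
  have key : ∀ ε > 0, 0 ≤ (M + ε) * (s t - x) - u x t + ε * t := by
    intro ε hε
    refine nonneg_of_strict_supersolution
      (w := fun y τ => (M + ε) * (s τ - y) - u y τ + ε * τ)
      (hsol.continuousOn_s.mono hsub) (fun τ hτ => hsol.s_pos τ (hsub hτ)) ?_ ?_ ?_ ?_ ?_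
      (x, t) ⟨right_mem_Icc.2 ht.1.le, hx⟩
    · have hs : ContinuousOn (fun p : ℝ × ℝ => s p.2) (closedRegion 0 t s) :=
        hsol.continuousOn_s.comp continuousOn_snd fun p hp => hsub hp.1
      have hu : ContinuousOn (fun p : ℝ × ℝ => u p.1 p.2) (closedRegion 0 t s) :=
        (hsol.continuousOn_closedRegion hT).mono fun p hp => ⟨hsub hp.1, hp.2⟩
      exact ((continuousOn_const.mul (hs.sub continuousOn_fst)).sub hu).add (by fun_prop)
    · intro τ hτ
      simpa [hsol.front_zero τ (hlift τ hτ)] using mul_nonneg hε.le hτ.1.le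
    · intro y hy
      rw [hsol.s_init] at hy
      have h₁ := hu₀M y hy
      have h₂ := mul_nonneg hε.le (sub_nonneg.2 hy.2)
      rw [hsol.init_Icc hb hT hu₀c y hy, hsol.s_init]
      linarith
    · intro τ hτ
      refine .inr ⟨(M + ε) * -1 - -(h τ), ?_, ?_⟩
      · linarith [hhM τ (Ioo_subset_Icc_self (hlift τ hτ))]
      · exact ((((hasDerivAt_id (0 : ℝ)).const_sub (s τ)).const_mul (M + ε)).sub
          (hsol.flux_hasDerivAt hhpos (hlift τ hτ))).add_const (ε * τ) |>.hasDerivWithinAt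
    · intro τ hτ y hy
      have hτ' := hlift τ hτ
      have hQ : (y, τ) ∈ stefanQ T s := ⟨hy.1, hy.2, hτ'⟩
      refine ⟨_, _, _, (hsol.eventually_hasDerivAt hQ).mono fun z hz =>
          ((((hasDerivAt_id z).const_sub (s τ)).const_mul (M + ε)).sub hz).add_const (ε * τ),
        (hsol.u_xx y τ hQ).const_sub _,
        ((((hsol.s_diff τ ⟨hτ'.1, hτ'.2.le⟩).sub_const y).const_mul (M + ε)).sub
          (hsol.heat y τ hQ)).add ((hasDerivAt_id τ).const_mul ε), ?_⟩
      have := mul_nonneg (add_nonneg hM hε.le)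
        (hsol.deriv_front_nonneg hb hhpos hu₀c hu₀ hτ')
      linarith
  have hden : 0 < s t - x + t := by linarith [hx.2, ht.1]
  refine le_of_forall_pos_le_add fun ε hε => ?_
  have := key (ε / (s t - x + t)) (div_pos hε hden)
  have hcancel := div_mul_cancel₀ ε hden.ne'
  linarith

end IsStefanSolution

/-- the temperature satisfies `0 < u(x,t) ≤ M (s(t) - x)` in `Q_{s,T}`,
where `M = max(sup_{[0,T]} h, H)`. -/
theorem stefan_temperature_bounds (b T H : ℝ) (hb : 0 < b) (hT : 0 < T) (hH : 0 < H)
    (h u₀ : ℝ → ℝ)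
    (hhc : ContinuousOn h (Icc 0 T)) (hhpos : ∀ t ∈ Icc (0:ℝ) T, 0 < h t)
    (hu₀c : ContinuousOn u₀ (Icc 0 b))
    (hu₀ : ∀ x ∈ Icc (0:ℝ) b, 0 ≤ u₀ x ∧ u₀ x ≤ H * (b - x))
    (M : ℝ) (hM : M = max (sSup (h '' Icc 0 T)) H)
    (s : ℝ → ℝ) (u : ℝ → ℝ → ℝ)
    (hsol : IsStefanSolution b T u₀ h s u) :
    ∀ x t, (x, t) ∈ stefanQ T s → 0 < u x t ∧ u x t ≤ M * (s t - x) := by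
  intro x t hxt
  have hhM : ∀ τ ∈ Icc (0:ℝ) T, h τ ≤ M := fun τ hτ => hM ▸
    (le_csSup (isCompact_Icc.image_of_continuousOn hhc).bddAbove (mem_image_of_mem h hτ)).trans
      (le_max_left _ _)
  have hHM : H ≤ M := hM ▸ le_max_right _ _
  have hu₀nonneg : ∀ y ∈ Icc (0:ℝ) b, 0 ≤ u₀ y := fun y hy => (hu₀ y hy).1
  have hu₀M : ∀ y ∈ Icc (0:ℝ) b, u₀ y ≤ M * (b - y) := fun y hy =>
    (hu₀ y hy).2.trans (mul_le_mul_of_nonneg_right hHM (sub_nonneg.2 hy.2))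
  exact ⟨hsol.pos hb hhpos hu₀c hu₀nonneg hxt,
    hsol.le_linear hb hhpos hu₀c hu₀nonneg (hH.le.trans hHM) hhM hu₀M hxt.2.2
      ⟨hxt.1.le, hxt.2.1.le⟩⟩
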